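/- Let a be an AIET which is a product of restricted rotations of pairwise disjoint supports I_1,...,I_p, each of infinite order, and let b be an AIET such that b a^m b^{-1} = a^n for integers m,n with a^m, a^n of infinite order. Then b permutes the intervals I_i, and there exists a positive integer s such that b^s maps each I_i to itself and preserves Lebesgue measure on each I_i. -/

import Mathlib

open Set Filter Function MeasureTheory Topology

noncomputable section

/-- Right derivative of `f` at `x`. -/
def rightD (f : ℝ → ℝ) (x : ℝ) : ℝ := derivWithin f (Set.Ici x) x

/-- Left derivative of `f` at `x`. -/
def leftD (f : ℝ → ℝ) (x : ℝ) : ℝ := derivWithin f (Set.Iic x) x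

/-- Break points of `f` on `[0,1)`: the point `0` together with the
discontinuities of `f` and of its (right) derivative in `(0,1)`. -/
def BP (f : ℝ → ℝ) : Set ℝ :=
  {0} ∪ {x ∈ Set.Ioo (0:ℝ) 1 |
    Function.leftLim f x ≠ f x ∨ Function.leftLim (rightD f) x ≠ rightD f x}

/-- An affine interval exchange transformation of `[0,1)`, modelled as a map of `ℝ`
that is the identity outside `[0,1)`, a bijection of `[0,1)` onto itself, and affine
with positive slope on the pieces of some finite subdivision `0 = a 0 < ... < a p = 1`. -/
structure IsAIET (f : ℝ → ℝ) : Prop where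
  bijOn : Set.BijOn f (Set.Ico 0 1) (Set.Ico 0 1)
  id_outside : ∀ x, x ∉ Set.Ico (0:ℝ) 1 → f x = x
  piecewise : ∃ (p : ℕ) (a : ℕ → ℝ), 0 < p ∧ a 0 = 0 ∧ a p = 1 ∧
    (∀ i j, i < j → j ≤ p → a i < a j) ∧
    ∀ i < p, ∃ lam beta : ℝ, 0 < lam ∧
      ∀ x ∈ Set.Ico (a i) (a (i+1)), f x = lam * x + beta

/-- The jump of slopes of `f` at `x` : `σ_f(x) = D₊f(x)/D₋f(x)` for `x ∈ (0,1)`, and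
`σ_f(0) = D₊f(0)/D₋f(1)`. -/
def jump (f : ℝ → ℝ) (x : ℝ) : ℝ :=
  if x = 0 then rightD f 0 / leftD f 1 else rightD f x / leftD f x

/-- The jump of values of `f` at `x` : `Δ_f(x) = f₊(x) - f₋(x)` for `x ∈ (0,1)`
(here `f₊(x) = f(x)` since AIETs are right-continuous), and `Δ_f(0) = f₊(0) - f₋(1)`. -/
def Δjump (f : ℝ → ℝ) (x : ℝ) : ℝ :=
  if x = 0 then f 0 - Function.leftLim f 1 else f x - Function.leftLim f x

/-- A PL-homeomorphism of `[0,1)` : an AIET which, seen on the circle `[0,1]/(0=1)`,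
is a homeomorphism; equivalently at any interior discontinuity the value jumps from `1` to `0`. -/
def IsPLHomeo (f : ℝ → ℝ) : Prop :=
  IsAIET f ∧ ∀ x ∈ Set.Ioo (0:ℝ) 1,
    Function.leftLim f x ≠ f x → f x = 0 ∧ Function.leftLim f x = 1

/-- Word length of `g` with respect to the finite set `S` (letters in `S ∪ S⁻¹`). -/
def wordLength {G : Type*} [Group G] (S : Finset G) (g : G) : ℕ :=
  sInf {n : ℕ | ∃ w : Fin n → G, (∀ i, w i ∈ S ∨ (w i)⁻¹ ∈ S) ∧ (List.ofFn w).prod = g}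

/-- The restricted rotation of `I = [a,b)` by `δ` (the identity outside `I`). -/
def RR (a b δ : ℝ) (x : ℝ) : ℝ :=
  if x ∈ Set.Ico a (b - δ) then x + δ
  else if x ∈ Set.Ico (b - δ) b then x + δ - (b - a) else x

/-- `f` is affine with slope `c` on a right neighbourhood of `x`. -/
def HasRightSlope (f : ℝ → ℝ) (x c : ℝ) : Prop :=
  ∃ ε > 0, ∀ t, 0 ≤ t → t < ε → f (x + t) = f x + c * t

/-- `g` maps `[l, r)` to itself, is there a translation by `d` modulo `r - l`, and is
right-continuous with slope one. -/
def IsCircleTranslation (l r d : ℝ) (g : ℝ → ℝ) : Prop :=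
  ∀ x ∈ Set.Ico l r, g x ∈ Set.Ico l r ∧ (∃ z : ℤ, g x = x + d + z * (r - l)) ∧
    HasRightSlope g x 1

namespace HasRightSlope

theorem unique {f : ℝ → ℝ} {x c d : ℝ} (hc : HasRightSlope f x c) (hd : HasRightSlope f x d) :
    c = d := by
  obtain ⟨ε, hε, h⟩ := hc
  obtain ⟨η, hη, k⟩ := hd
  have hpos : 0 < min ε η := lt_min hε hη
  have h1 := h (min ε η / 2) (by positivity) (by linarith [min_le_left ε η])
  have h2 := k (min ε η / 2) (by positivity) (by linarith [min_le_right ε η])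
  have h3 : c * (min ε η / 2) = d * (min ε η / 2) := by linarith
  exact mul_right_cancel₀ (by positivity) h3

theorem comp {f g : ℝ → ℝ} {x c d : ℝ} (hg : HasRightSlope g (f x) d) (hc : 0 < c)
    (hf : HasRightSlope f x c) : HasRightSlope (g ∘ f) x (d * c) := by
  obtain ⟨ε, hε, h⟩ := hf
  obtain ⟨η, hη, k⟩ := hg
  refine ⟨min ε (η / c), lt_min hε (by positivity), fun t ht0 ht => ?_⟩
  have h1 := h t ht0 (ht.trans_le (min_le_left _ _))
  have h2 : c * t < η := by
    have := ht.trans_le (min_le_right _ _)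
    rw [lt_div_iff₀ hc] at this
    linarith
  simp only [comp_apply, h1, k (c * t) (by positivity) h2]
  ring

theorem eventually_right {f : ℝ → ℝ} {x c : ℝ} (hf : HasRightSlope f x c) :
    ∃ ε > 0, ∀ t, 0 ≤ t → t < ε → HasRightSlope f (x + t) c := by
  obtain ⟨ε, hε, h⟩ := hf
  refine ⟨ε, hε, fun t ht0 ht => ⟨ε - t, by linarith, fun u hu0 hu => ?_⟩⟩
  rw [add_assoc, h (t + u) (by linarith) (by linarith), h t ht0 ht]
  ring

theorem symm_of_one {e : Equiv.Perm ℝ} {x : ℝ} (h : HasRightSlope e (e⁻¹ x) 1) :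
    HasRightSlope ⇑e⁻¹ x 1 := by
  obtain ⟨ε, hε, h⟩ := h
  refine ⟨ε, hε, fun t ht0 ht => ?_⟩
  have := h t ht0 ht
  rw [show e (e⁻¹ x) = x from e.apply_symm_apply x, one_mul] at this
  rw [← this, show e⁻¹ (e (e⁻¹ x + t)) = _ from e.symm_apply_apply _, one_mul]

end HasRightSlope

namespace IsCircleTranslation

theorem comp {l r d e : ℝ} {g h : ℝ → ℝ} (hg : IsCircleTranslation l r d g)
    (hh : IsCircleTranslation l r e h) : IsCircleTranslation l r (d + e) (g ∘ h) := by
  intro x hx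
  obtain ⟨hm, ⟨z, hz⟩, hs⟩ := hh x hx
  obtain ⟨gm, ⟨w, hw⟩, gs⟩ := hg _ hm
  refine ⟨gm, ⟨w + z, ?_⟩, ?_⟩
  · simp only [comp_apply, hw]
    rw [hz]
    push_cast
    ring
  · simpa using gs.comp one_pos hs

theorem zpow {l r d : ℝ} {g : Equiv.Perm ℝ} (hg : IsCircleTranslation l r d g)
    (hg' : IsCircleTranslation l r (-d) ⇑g⁻¹) (k : ℤ) :
    IsCircleTranslation l r (k * d) ⇑(g ^ k) := by
  induction k with
  | zero =>
    intro x hx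
    exact ⟨by simpa using hx, ⟨0, by simp⟩, ⟨1, one_pos, fun t _ _ => by simp⟩⟩
  | succ k ih =>
    rw [zpow_add_one, Equiv.Perm.coe_mul]
    convert ih.comp hg using 1
    push_cast
    ring
  | pred k ih =>
    rw [zpow_sub_one, Equiv.Perm.coe_mul]
    convert ih.comp hg' using 1
    push_cast
    ring

theorem of_eq_RR {l r δ : ℝ} (hδ : 0 < δ ∧ δ < r - l) {g : ℝ → ℝ}
    (hg : ∀ x ∈ Set.Ico l r, g x = RR l r δ x) : IsCircleTranslation l r δ g := by
  obtain ⟨h0, h1⟩ := hδ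
  intro x hx
  by_cases hlt : x < r - δ
  · have key : ∀ y, l ≤ y → y < r - δ → g y = y + δ := fun y hy hy' => by
      rw [hg y ⟨hy, by linarith⟩, RR, if_pos ⟨hy, hy'⟩]
    refine ⟨?_, ⟨0, ?_⟩, r - δ - x, by linarith, fun t ht0 ht => ?_⟩
    · rw [key x hx.1 hlt]
      exact ⟨by linarith [hx.1], by linarith⟩
    · rw [key x hx.1 hlt]
      simp
    · rw [key x hx.1 hlt, key _ (by linarith [hx.1]) (by linarith)]
      ring
  · have key : ∀ y, r - δ ≤ y → y < r → g y = y + δ - (r - l) := fun y hy hy' => by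
      rw [hg y ⟨by linarith, hy'⟩, RR, if_neg (fun h => by linarith [h.2]), if_pos ⟨hy, hy'⟩]
    push Not at hlt
    refine ⟨?_, ⟨-1, ?_⟩, r - x, by linarith [hx.2], fun t ht0 ht => ?_⟩
    · rw [key x hlt hx.2]
      exact ⟨by linarith, by linarith [hx.2]⟩
    · rw [key x hlt hx.2]
      push_cast
      ring
    · rw [key x hlt hx.2, key _ (by linarith) (by linarith)]
      ring

theorem inv_of_eq_RR {l r δ : ℝ} (hδ : 0 < δ ∧ δ < r - l) {g : Equiv.Perm ℝ}
    (hg : ∀ x ∈ Set.Ico l r, g x = RR l r δ x) : IsCircleTranslation l r (-δ) ⇑g⁻¹ := by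
  intro x hx
  have hpre : ∃ y ∈ Set.Ico l r, g y = x := by
    by_cases hlt : l + δ ≤ x
    · have hy : x - δ ∈ Set.Ico l r := ⟨by linarith, by linarith [hx.2]⟩
      refine ⟨x - δ, hy, ?_⟩
      rw [hg _ hy, RR, if_pos ⟨hy.1, by linarith [hx.2]⟩]
      ring
    · have hy : x - δ + (r - l) ∈ Set.Ico l r := ⟨by linarith [hx.1], by linarith⟩
      refine ⟨_, hy, ?_⟩
      rw [hg _ hy, RR, if_neg (fun h => by linarith [h.2, hx.1]),
        if_pos ⟨by linarith [hx.1], hy.2⟩]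
      ring
  obtain ⟨y, hy, rfl⟩ := hpre
  obtain ⟨-, ⟨z, hz⟩, hs⟩ := of_eq_RR hδ hg y hy
  refine ⟨by simpa using hy, ⟨-z, ?_⟩, HasRightSlope.symm_of_one (by simpa using hs)⟩
  rw [show g⁻¹ (g y) = y from g.symm_apply_apply y, hz]
  push_cast
  ring

theorem ne_self {l r d : ℝ} {g : ℝ → ℝ} (hg : IsCircleTranslation l r d g)
    (hd : Irrational (d / (r - l))) {x : ℝ} (hx : x ∈ Set.Ico l r) : g x ≠ x := by
  intro h
  obtain ⟨-, ⟨z, hz⟩, -⟩ := hg x hx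
  have hL : r - l ≠ 0 := by linarith [hx.1, hx.2]
  refine hd ⟨-z, ?_⟩
  rw [eq_div_iff hL]
  push_cast
  linarith

theorem exists_zpow_mem_Ioo {l r d : ℝ} {g : Equiv.Perm ℝ}
    (hg : ∀ k : ℤ, IsCircleTranslation l r (k * d) ⇑(g ^ k)) (hd : Irrational (d / (r - l)))
    {x y : ℝ} (hx : x ∈ Set.Ico l r) (hy : y ∈ Set.Ico l r) {ε : ℝ} (hε : 0 < ε) :
    ∃ k : ℤ, (g ^ k) x ∈ Set.Ioo y (y + ε) := by
  have hdense := dense_addSubgroupClosure_pair_iff.2 hd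
  obtain ⟨w, hw, hwI⟩ := hdense.exists_between
    (show y - x < min (y + ε) r - x by
      have : y < min (y + ε) r := lt_min (by linarith) hy.2
      linarith)
  obtain ⟨k, q, rfl⟩ := AddSubgroup.mem_closure_pair.1 hw
  simp only [zsmul_eq_mul] at hwI
  obtain ⟨hm, ⟨z, hz⟩, -⟩ := hg k x hx
  have hmin1 := min_le_left (y + ε) r
  have hmin2 := min_le_right (y + ε) r
  have hL : 0 < r - l := by linarith [hx.1, hx.2]
  obtain ⟨h1, h2⟩ := hwI
  have hzq : z = q := by
    have hlt : ((z - q : ℤ) : ℝ) * (r - l) < 1 * (r - l) := by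
      push_cast
      linarith [hm.2, hy.1]
    have hgt : (-1) * (r - l) < ((z - q : ℤ) : ℝ) * (r - l) := by
      push_cast
      linarith [hm.1]
    have hlt' := lt_of_mul_lt_mul_right hlt hL.le
    have hgt' := lt_of_mul_lt_mul_right hgt hL.le
    have : z - q < 1 := by exact_mod_cast hlt'
    have : -1 < z - q := by exact_mod_cast hgt'
    omega
  subst hzq
  exact ⟨k, by linarith, by linarith⟩

end IsCircleTranslation

namespace IsAIET

theorem exists_mem_piece {p : ℕ} {a : ℕ → ℝ} (h0 : a 0 = 0) (hp : a p = 1) {x : ℝ}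
    (hx : x ∈ Set.Ico (0 : ℝ) 1) : ∃ i < p, x ∈ Set.Ico (a i) (a (i + 1)) := by
  have hex : ∃ j, x < a j := ⟨p, hp ▸ hx.2⟩
  classical
  have hpos : Nat.find hex ≠ 0 := fun h => by
    have := Nat.find_spec hex
    rw [h, h0] at this
    linarith [hx.1]
  obtain ⟨i, hi⟩ := Nat.exists_eq_succ_of_ne_zero hpos
  have hle : Nat.find hex ≤ p := Nat.find_min' hex (hp ▸ hx.2)
  exact ⟨i, by omega, not_lt.1 (Nat.find_min hex (by omega)),
    by simpa [hi] using Nat.find_spec hex⟩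

theorem exists_hasRightSlope {f : ℝ → ℝ} (hf : IsAIET f) {x : ℝ} (hx : x ∈ Set.Ico (0 : ℝ) 1) :
    ∃ c > 0, HasRightSlope f x c := by
  obtain ⟨p, a, -, h0, h1, -, hpc⟩ := hf.piecewise
  obtain ⟨i, hi, hxi⟩ := exists_mem_piece h0 h1 hx
  obtain ⟨lam, beta, hlam, h⟩ := hpc i hi
  refine ⟨lam, hlam, a (i + 1) - x, by linarith [hxi.2], fun t ht0 ht => ?_⟩
  rw [h x hxi, h _ ⟨by linarith [hxi.1], by linarith⟩]
  ring

theorem measurable {f : ℝ → ℝ} (hf : IsAIET f) : Measurable f := by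
  obtain ⟨p, a, -, h0, h1, hmono, hpc⟩ := hf.piecewise
  choose! lam beta hlam h using hpc
  intro T hT
  have hpre : f ⁻¹' T = (⋃ i ∈ Finset.range p,
      Set.Ico (a i) (a (i + 1)) ∩ (fun x => lam i * x + beta i) ⁻¹' T) ∪
      (Set.Ico (0 : ℝ) 1)ᶜ ∩ T := by
    have hsub : ∀ i < p, Set.Ico (a i) (a (i + 1)) ⊆ Set.Ico (0 : ℝ) 1 := by
      intro i hi
      refine Set.Ico_subset_Ico ?_ ?_
      · rcases Nat.eq_zero_or_pos i with rfl | hi0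
        · exact h0.ge
        · exact h0 ▸ (hmono 0 i hi0 hi.le).le
      · rcases (Nat.succ_le_of_lt hi).eq_or_lt with h' | h'
        · exact ((congrArg a h').trans h1).le
        · exact h1 ▸ (hmono (i + 1) p h' le_rfl).le
    ext x
    simp only [Set.mem_preimage, Set.mem_union, Set.mem_iUnion, Finset.mem_range, Set.mem_inter_iff,
      exists_prop, Set.mem_compl_iff]
    constructor
    · intro hx
      by_cases hx01 : x ∈ Set.Ico (0 : ℝ) 1
      · obtain ⟨i, hi, hxi⟩ := exists_mem_piece h0 h1 hx01
        exact Or.inl ⟨i, hi, hxi, h i hi x hxi ▸ hx⟩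
      · exact Or.inr ⟨hx01, hf.id_outside x hx01 ▸ hx⟩
    · rintro (⟨i, hi, hxi, hx⟩ | ⟨hx01, hx⟩)
      · rwa [h i hi x hxi]
      · rwa [hf.id_outside x hx01]
  rw [hpre]
  refine MeasurableSet.union (Finset.measurableSet_biUnion _ fun i _ => ?_)
    (measurableSet_Ico.compl.inter hT)
  exact measurableSet_Ico.inter ((by fun_prop : Measurable fun x => lam i * x + beta i) hT)

theorem exists_finite_hasDerivAt {f : ℝ → ℝ} (hf : IsAIET f) :
    ∃ F : Set ℝ, F.Finite ∧ ∀ x ∈ Set.Ico (0 : ℝ) 1 \ F, ∀ c, HasRightSlope f x c →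
      HasDerivAt f c x := by
  obtain ⟨p, a, -, h0, h1, -, hpc⟩ := hf.piecewise
  refine ⟨a '' Set.Iio p, (Set.finite_Iio p).image a, ?_⟩
  rintro x ⟨hx, hxF⟩ c hc
  obtain ⟨i, hi, hxi⟩ := exists_mem_piece h0 h1 hx
  obtain ⟨lam, beta, hlam, h⟩ := hpc i hi
  have hlt : a i < x := lt_of_le_of_ne hxi.1 fun h => hxF ⟨i, hi, h⟩
  have hs : HasRightSlope f x lam := by
    refine ⟨a (i + 1) - x, by linarith [hxi.2], fun t ht0 ht => ?_⟩
    rw [h x hxi, h _ ⟨by linarith [hxi.1], by linarith⟩]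
    ring
  rw [hc.unique hs]
  have hd : HasDerivAt (fun y => lam * y + beta) lam x := by
    simpa using ((hasDerivAt_id x).const_mul lam).add_const beta
  refine hd.congr_of_eventuallyEq ?_
  filter_upwards [Ioo_mem_nhds hlt hxi.2] with y hy using h y ⟨hy.1.le, hy.2⟩

theorem volume_image {f : ℝ → ℝ} (hf : IsAIET f) (hinj : Function.Injective f) {c : ℝ}
    (hc : 0 < c) {A : Set ℝ} (hA : MeasurableSet A) (hA01 : A ⊆ Set.Ico (0 : ℝ) 1)
    (hs : ∀ x ∈ A, HasRightSlope f x c) :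
    volume (f '' A) = ENNReal.ofReal c * volume A := by
  obtain ⟨F, hF, hd⟩ := hf.exists_finite_hasDerivAt
  have hkey := lintegral_image_eq_lintegral_abs_deriv_mul (s := A \ F) (f := f)
    (f' := fun _ => c) (hA.diff hF.measurableSet)
    (fun x hx => (hd x ⟨hA01 hx.1, hx.2⟩ c (hs x hx.1)).hasDerivWithinAt) hinj.injOn
    (fun _ => 1)
  simp only [lintegral_const, MeasurableSet.univ, Measure.restrict_apply, Set.univ_inter, one_mul,
    mul_one, abs_of_pos hc] at hkey
  rw [Set.image_sdiff hinj, measure_sdiff_null ((hF.image f).measure_zero _),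
    measure_sdiff_null (hF.measure_zero _)] at hkey
  exact hkey

theorem map_normalized_restrict {f : ℝ → ℝ} (hf : IsAIET f) (hinj : Function.Injective f) {c : ℝ}
    (hc : 0 < c) {A : Set ℝ} (hA : MeasurableSet A) (hA01 : A ⊆ Set.Ico (0 : ℝ) 1)
    (hs : ∀ x ∈ A, HasRightSlope f x c) :
    Measure.map f ((volume A)⁻¹ • volume.restrict A) =
      (volume (f '' A))⁻¹ • volume.restrict (f '' A) := by
  have hc0 : ENNReal.ofReal c ≠ 0 := by simpa using hc
  ext T hT
  rw [Measure.map_apply hf.measurable hT, Measure.smul_apply, Measure.smul_apply,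
    Measure.restrict_apply hT, Measure.restrict_apply (hf.measurable hT), Set.inter_comm T,
    ← Set.image_inter_preimage, hf.volume_image hinj hc hA hA01 hs,
    hf.volume_image hinj hc (hA.inter (hf.measurable hT)) (Set.inter_subset_left.trans hA01)
      (fun x hx => hs x hx.1), Set.inter_comm, smul_eq_mul, smul_eq_mul,
    ENNReal.mul_inv (Or.inl hc0) (Or.inl ENNReal.ofReal_ne_top), mul_mul_mul_comm,
    ENNReal.inv_mul_cancel hc0 ENNReal.ofReal_ne_top, one_mul]

end IsAIET

section Conjugacy

variable {l r d l' r' e : ℝ} {b g h : Equiv.Perm ℝ}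

theorem mem_Ico_of_conj (hb : IsAIET b) (hsub : Set.Ico l r ⊆ Set.Ico (0 : ℝ) 1)
    (hg : ∀ k : ℤ, IsCircleTranslation l r (k * d) ⇑(g ^ k)) (hd : Irrational (d / (r - l)))
    (hh : ∀ k : ℤ, IsCircleTranslation l' r' (k * e) ⇑(h ^ k))
    (hconj : ∀ (k : ℤ) x, b ((g ^ k) x) = (h ^ k) (b x))
    {x y : ℝ} (hx : x ∈ Set.Ico l r) (hbx : b x ∈ Set.Ico l' r') (hy : y ∈ Set.Ico l r) :
    b y ∈ Set.Ico l' r' := by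
  obtain ⟨c, hc, ε, hε, hs⟩ := hb.exists_hasRightSlope (hsub hy)
  have key : ∀ η > 0, η ≤ ε → ∃ t > 0, t < η ∧ b y + c * t ∈ Set.Ico l' r' := by
    intro η hη hηε
    obtain ⟨k, hk1, hk2⟩ := IsCircleTranslation.exists_zpow_mem_Ioo hg hd hx hy hη
    refine ⟨(g ^ k) x - y, by linarith, by linarith, ?_⟩
    rw [← hs _ (by linarith) (by linarith), add_sub_cancel, hconj]
    exact (hh k _ hbx).1
  constructor
  · by_contra! hlt
    obtain ⟨t, ht0, ht, htm⟩ := key (min ε ((l' - b y) / c))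
      (lt_min hε (div_pos (by linarith) hc)) (min_le_left _ _)
    have := ht.trans_le (min_le_right _ _)
    rw [lt_div_iff₀ hc] at this
    linarith [htm.1]
  · obtain ⟨t, ht0, ht, htm⟩ := key ε hε le_rfl
    have := mul_pos hc ht0
    linarith [htm.2]

theorem exists_constant_slope_of_conj (hb : IsAIET b) (hlr : l < r)
    (hsub : Set.Ico l r ⊆ Set.Ico (0 : ℝ) 1)
    (hg : ∀ k : ℤ, IsCircleTranslation l r (k * d) ⇑(g ^ k)) (hd : Irrational (d / (r - l)))
    (hh : ∀ k : ℤ, IsCircleTranslation l' r' (k * e) ⇑(h ^ k))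
    (hconj : ∀ (k : ℤ) x, b ((g ^ k) x) = (h ^ k) (b x))
    (hbl : b l ∈ Set.Ico l' r') :
    ∃ c > 0, ∀ y ∈ Set.Ico l r, HasRightSlope b y c := by
  have hl : l ∈ Set.Ico l r := ⟨le_rfl, hlr⟩
  obtain ⟨c, hc, hcs⟩ := hb.exists_hasRightSlope (hsub hl)
  refine ⟨c, hc, fun y hy => ?_⟩
  obtain ⟨c', hc', hs⟩ := hb.exists_hasRightSlope (hsub hy)
  obtain ⟨ε, hε, hs'⟩ := hs.eventually_right
  obtain ⟨k, hk1, hk2⟩ := IsCircleTranslation.exists_zpow_mem_Ioo hg hd hl hy hε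
  have h1 := hs' ((g ^ k) l - y) (by linarith) (by linarith)
  rw [add_sub_cancel] at h1
  have h2 := h1.comp one_pos (hg k l hl).2.2
  have h3 := HasRightSlope.comp (hh k _ hbl).2.2 hc hcs
  rw [show ⇑b ∘ ⇑(g ^ k) = ⇑(h ^ k) ∘ ⇑b from funext (hconj k)] at h2
  have := h2.unique h3
  rw [mul_one, one_mul] at this
  exact this ▸ hs

end Conjugacy

theorem exists_perm_image_eq_of_mapsTo {α ι : Type*} [Finite ι] {I : ι → Set α}
    (hne : ∀ i, (I i).Nonempty) (hdisj : ∀ i j, i ≠ j → Disjoint (I i) (I j))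
    (b : Equiv.Perm α) (hU : ∀ x, b x ∈ ⋃ i, I i → x ∈ ⋃ i, I i)
    (hmaps : ∀ i, ∃ j, Set.MapsTo b (I i) (I j)) :
    ∃ σ : Equiv.Perm ι, ∀ i, b '' I i = I (σ i) := by
  have huniq : ∀ {i j x}, x ∈ I i → x ∈ I j → i = j := fun {i j x} hi hj => by
    by_contra hij
    exact Set.disjoint_left.1 (hdisj i j hij) hi hj
  choose τ hτ using hmaps
  have hpre : ∀ j, ∀ y ∈ I j, ∃ i, ∃ x ∈ I i, b x = y ∧ τ i = j := by
    intro j y hy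
    obtain ⟨i, hi⟩ := Set.mem_iUnion.1 (hU (b⁻¹ y) (Set.mem_iUnion.2 ⟨j, by simpa using hy⟩))
    have hb : b (b⁻¹ y) = y := b.apply_symm_apply y
    exact ⟨i, _, hi, hb, huniq (hτ i hi) (by rwa [hb])⟩
  have hsurj : Function.Surjective τ := fun j => by
    obtain ⟨y, hy⟩ := hne j
    obtain ⟨i, -, -, -, h⟩ := hpre j y hy
    exact ⟨i, h⟩
  have hbij := Function.Surjective.bijective_of_finite hsurj
  refine ⟨Equiv.ofBijective τ hbij, fun i => ?_⟩
  refine Set.Subset.antisymm (Set.image_subset_iff.2 (hτ i)) fun y hy => ?_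
  obtain ⟨i', x, hx, hxy, hi'⟩ := hpre _ y hy
  exact ⟨x, hbij.1 hi' ▸ hx, hxy⟩

theorem stmt_17 (p : ℕ) (hp : 0 < p) (l r δ : Fin p → ℝ)
    (hlr : ∀ i, l i < r i)
    (hsub : ∀ i, Set.Ico (l i) (r i) ⊆ Set.Ico (0:ℝ) 1)
    (hdisj : ∀ i j, i ≠ j → Disjoint (Set.Ico (l i) (r i)) (Set.Ico (l j) (r j)))
    (hδ : ∀ i, 0 < δ i ∧ δ i < r i - l i)
    (hirr : ∀ i, Irrational (δ i / (r i - l i)))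
    (a b : Equiv.Perm ℝ) (ha : IsAIET ⇑a) (hb : IsAIET ⇑b)
    (haRR : ∀ i, ∀ x ∈ Set.Ico (l i) (r i), a x = RR (l i) (r i) (δ i) x)
    (haid : ∀ x, x ∉ ⋃ i, Set.Ico (l i) (r i) → a x = x)
    (m n : ℤ) (hm : ¬ IsOfFinOrder (a ^ m)) (hn : ¬ IsOfFinOrder (a ^ n))
    (hconj : b * a ^ m * b⁻¹ = a ^ n) :
    (∃ σ : Equiv.Perm (Fin p), ∀ i,
      ⇑b '' Set.Ico (l i) (r i) = Set.Ico (l (σ i)) (r (σ i))) ∧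
    ∃ s : ℕ, 0 < s ∧ ∀ i,
      ⇑(b ^ s) '' Set.Ico (l i) (r i) = Set.Ico (l i) (r i) ∧
      Measure.map ⇑(b ^ s) (volume.restrict (Set.Ico (l i) (r i))) =
        volume.restrict (Set.Ico (l i) (r i)) := by
  have hm0 : m ≠ 0 := by
    rintro rfl
    exact hm (by simp)
  have hn0 : n ≠ 0 := by
    rintro rfl
    exact hn (by simp)
  have htr : ∀ i (k : ℤ), IsCircleTranslation (l i) (r i) (k * δ i) ⇑(a ^ k) := fun i =>
    IsCircleTranslation.zpow (.of_eq_RR (hδ i) (haRR i)) (.inv_of_eq_RR (hδ i) (haRR i))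
  have htr' : ∀ i (q k : ℤ), IsCircleTranslation (l i) (r i) (k * (q * δ i)) ⇑((a ^ q) ^ k) := by
    intro i q k
    rw [← zpow_mul]
    convert htr i (q * k) using 1
    push_cast
    ring
  have hirr' : ∀ i (q : ℤ), q ≠ 0 → Irrational (q * δ i / (r i - l i)) := fun i q hq => by
    rw [mul_div_assoc]
    exact (hirr i).intCast_mul hq
  have hfix : ∀ q : ℤ, q ≠ 0 → ∀ x, x ∈ ⋃ i, Set.Ico (l i) (r i) ↔ (a ^ q) x ≠ x := by
    intro q hq x
    constructor
    · intro hx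
      obtain ⟨i, hi⟩ := Set.mem_iUnion.1 hx
      exact (htr i q).ne_self (hirr' i q hq) hi
    · contrapose!
      exact fun hx => Function.IsFixedPt.perm_zpow (haid x hx) q
  have hcomm : ∀ (k : ℤ) x, b (((a ^ m) ^ k) x) = ((a ^ n) ^ k) (b x) := by
    intro k x
    rw [← hconj, conj_zpow]
    simp
  have hU : ∀ x, b x ∈ ⋃ i, Set.Ico (l i) (r i) ↔ x ∈ ⋃ i, Set.Ico (l i) (r i) := by
    intro x
    have h1 := hcomm 1 x
    rw [zpow_one, zpow_one] at h1
    rw [hfix n hn0 (b x), hfix m hm0 x, ← h1, b.injective.ne_iff]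
  have hbl : ∀ i, ∃ j, b (l i) ∈ Set.Ico (l j) (r j) := fun i =>
    Set.mem_iUnion.1 ((hU _).2 (Set.mem_iUnion.2 ⟨i, le_rfl, hlr i⟩))
  obtain ⟨σ, hσ⟩ := exists_perm_image_eq_of_mapsTo (I := fun i => Set.Ico (l i) (r i))
    (fun i => Set.nonempty_Ico.2 (hlr i)) hdisj b (fun x => (hU x).1) fun i => by
      obtain ⟨j, hj⟩ := hbl i
      exact ⟨j, fun y hy => mem_Ico_of_conj hb (hsub i) (htr' i m) (hirr' i m hm0) (htr' j n)
        hcomm ⟨le_rfl, hlr i⟩ hj hy⟩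
  have hvol : ∀ i, volume (Set.Ico (l i) (r i)) ≠ 0 := fun i => by
    simpa using hlr i
  have hmap : ∀ i, Measure.map b ((volume (Set.Ico (l i) (r i)))⁻¹ •
      volume.restrict (Set.Ico (l i) (r i))) =
      (volume (Set.Ico (l (σ i)) (r (σ i))))⁻¹ •
        volume.restrict (Set.Ico (l (σ i)) (r (σ i))) := by
    intro i
    obtain ⟨j, hj⟩ := hbl i
    obtain ⟨c, hc, hs⟩ := exists_constant_slope_of_conj hb (hlr i) (hsub i) (htr' i m)
      (hirr' i m hm0) (htr' j n) hcomm hj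
    rw [← hσ i]
    exact hb.map_normalized_restrict b.injective hc measurableSet_Ico (hsub i) hs
  have hmeas : ∀ k : ℕ, Measurable ⇑(b ^ k) := fun k => by
    rw [← Equiv.Perm.iterate_eq_pow]
    exact hb.measurable.iterate k
  have hpow : ∀ (k : ℕ) i, ⇑(b ^ k) '' Set.Ico (l i) (r i) =
      Set.Ico (l ((σ ^ k) i)) (r ((σ ^ k) i)) ∧
      Measure.map ⇑(b ^ k) ((volume (Set.Ico (l i) (r i)))⁻¹ •
        volume.restrict (Set.Ico (l i) (r i))) =
      (volume (Set.Ico (l ((σ ^ k) i)) (r ((σ ^ k) i))))⁻¹ •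
        volume.restrict (Set.Ico (l ((σ ^ k) i)) (r ((σ ^ k) i))) := by
    intro k
    induction k with
    | zero => simp [Measure.map_id]
    | succ k ih =>
      intro i
      rw [pow_succ, pow_succ, Equiv.Perm.coe_mul, Equiv.Perm.mul_apply, Set.image_comp, hσ,
        ← Measure.map_map (hmeas k) hb.measurable, hmap]
      exact ih (σ i)
  refine ⟨⟨σ, hσ⟩, orderOf σ, orderOf_pos σ, fun i => ?_⟩
  obtain ⟨h1, h2⟩ := hpow (orderOf σ) i
  rw [pow_orderOf_eq_one, Equiv.Perm.one_apply] at h1 h2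
  refine ⟨h1, ?_⟩
  rw [Measure.map_smul] at h2
  have h3 := congrArg (fun μ : Measure ℝ => volume (Set.Ico (l i) (r i)) • μ) h2
  simpa only [smul_smul, ENNReal.mul_inv_cancel (hvol i) (by simp), one_smul] using h3
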